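/- arXiv:1503.02489 — 3 statements merged into one kernel-verified Lean document; each statement's English description precedes it below -/
import Mathlib

section
/- Let R be a commutative ring in which 2 is invertible, let q be a symmetric invertible n×n matrix over R, and let g be any symmetric n×n matrix over R (playing the role of a derivative D(q) of q). Then there exists a unique n×n matrix A over R satisfying the two conditions Aᵀq = qA and g + Aᵀq + qA = 0, namely A = −(1/2)·q⁻¹·g. In particular, for each derivation D of R there is a unique matrix A with Aᵀq = qA and D(q) + Aᵀq + qA = 0 (where D(q) is the entrywise derivative), namely A = −(1/2)·q⁻¹·D(q); this A defines the Chern connection attached to q. -/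
open Matrix

theorem stmt4_aux {R : Type*} [CommRing R] [Invertible (2 : R)] (n : ℕ)
    (q : Matrix (Fin n) (Fin n) R) (hq : qᵀ = q) (hqinv : IsUnit q)
    (g : Matrix (Fin n) (Fin n) R) (hg : gᵀ = g) (A : Matrix (Fin n) (Fin n) R) :
      (Aᵀ * q = q * A ∧ g + Aᵀ * q + q * A = 0) ↔ A = -((⅟(2 : R)) • (q⁻¹ * g)) := by
  have hd : IsUnit q.det := (Matrix.isUnit_iff_isUnit_det q).1 hqinv
  have half : ∀ M : Matrix (Fin n) (Fin n) R, ⅟(2 : R) • (M + M) = M := by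
    intro M
    rw [← two_smul R M, smul_smul, invOf_mul_self, one_smul]
  constructor
  · rintro ⟨h1, h2⟩
    rw [h1, add_assoc] at h2
    have h3 : g = -(q * A + q * A) := eq_neg_of_add_eq_zero_left h2
    rw [h3, mul_neg, mul_add, ← Matrix.mul_assoc, Matrix.nonsing_inv_mul q hd, Matrix.one_mul,
      smul_neg, neg_neg, half]
  · intro h
    have h1 : q * A = -(⅟(2 : R) • g) := by
      rw [h, mul_neg, Matrix.mul_smul, ← Matrix.mul_assoc, Matrix.mul_nonsing_inv q hd,
        Matrix.one_mul]
    have h2 : Aᵀ * q = -(⅟(2 : R) • g) := by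
      have h3 := congrArg Matrix.transpose h1
      rwa [Matrix.transpose_mul, hq, Matrix.transpose_neg, Matrix.transpose_smul, hg] at h3
    refine ⟨h2.trans h1.symm, ?_⟩
    rw [h1, h2, add_assoc, ← neg_add, ← smul_add, half, add_neg_cancel]

/-- Let `R` be a commutative ring in which `2` is invertible, let `q` be a
symmetric invertible `n × n` matrix over `R`, and let `g` be any symmetric `n × n` matrix over
`R` (playing the role of a derivative `D q` of `q`). Then there exists a unique matrix `A`
with `Aᵀ * q = q * A` and `g + Aᵀ * q + q * A = 0`, namely `A = −(1/2) · q⁻¹ * g`.  In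
particular, for each derivation `D` of `R` there is a unique `A` with `Aᵀ * q = q * A` and
`D q + Aᵀ * q + q * A = 0` (with `D q` the entrywise derivative), namely
`A = −(1/2) · q⁻¹ * D q`; this `A` defines the Chern connection attached to `q`. -/
theorem stmt4 {R : Type*} [CommRing R] [Invertible (2 : R)] (n : ℕ)
    (q : Matrix (Fin n) (Fin n) R) (hq : qᵀ = q) (hqinv : IsUnit q)
    (g : Matrix (Fin n) (Fin n) R) (hg : gᵀ = g) :
    (∀ A : Matrix (Fin n) (Fin n) R,
      (Aᵀ * q = q * A ∧ g + Aᵀ * q + q * A = 0) ↔ A = -((⅟(2 : R)) • (q⁻¹ * g))) ∧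
    (∀ D : Derivation ℤ R R, ∀ A : Matrix (Fin n) (Fin n) R,
      (Aᵀ * q = q * A ∧ q.map (⇑D) + Aᵀ * q + q * A = 0) ↔
        A = -((⅟(2 : R)) • (q⁻¹ * q.map (⇑D)))) := by
  exact ⟨stmt4_aux n q hq hqinv g hg, fun D =>
    stmt4_aux n q hq hqinv _ (by rw [← Matrix.transpose_map, hq])⟩
end

section
/- Let R be a commutative ring, D : R → R a derivation, n a positive integer, and let B be the polynomial ring over R in the n² variables x_{jk} (the entries of an n×n matrix x of indeterminates). Let A and q be n×n matrices over R and let δ : B → B be a derivation that restricts to D on R and satisfies δ(x_{jk}) = (A·x)_{jk} for all j, k. Then δ annihilates all entries of the matrix xᵀ·q·x (i.e., q is parallel, equivalently the diagram defining horizontality of the map H_q(x) = xᵀqx with respect to δ and the trivial connection commutes) if and only if D(q) + Aᵀ·q + q·A = 0, where D(q) is the entrywise derivative of q. -/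
open Matrix

/-- The generic `n × n` matrix `x = (x j k)` whose entries are the variables of the
polynomial ring `B = R[x j k]` in `n²` indeterminates. -/
noncomputable def genMat (R : Type*) [CommRing R] (n : ℕ) :
    Matrix (Fin n) (Fin n) (MvPolynomial (Fin n × Fin n) R) :=
  Matrix.of fun j k => MvPolynomial.X (j, k)

theorem stmt6_map_mul {k B : Type*} [CommRing k] [CommRing B] [Algebra k B] [Module k B]
    (n : ℕ) (δ : Derivation k B B)
    (M N : Matrix (Fin n) (Fin n) B) :
    (M * N).map ⇑δ = M.map ⇑δ * N + M * N.map ⇑δ := by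
  ext i j
  simp only [Matrix.map_apply, Matrix.mul_apply, Matrix.add_apply, map_sum, Derivation.leibniz,
    smul_eq_mul, ← Finset.sum_add_distrib]
  exact Finset.sum_congr rfl fun k _ => by ring

/-- Let `R` be a commutative ring, `D : R → R` a derivation, `n` a positive
integer, and `B` the polynomial ring over `R` in the `n²` variables `x j k` (the entries of
an `n × n` matrix `x` of indeterminates). Let `A` and `q` be `n × n` matrices over `R` and
`δ : B → B` a derivation restricting to `D` on `R` with `δ x = A * x` (entrywise). Then `δ`
annihilates all entries of `xᵀ * q * x` (i.e. `q` is parallel, equivalently the diagram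
defining horizontality of `H_q x = xᵀ * q * x` with respect to `δ` and the trivial connection
commutes) if and only if `D q + Aᵀ * q + q * A = 0`, `D q` the entrywise derivative. -/
theorem stmt6 {R : Type*} [CommRing R] (D : Derivation ℤ R R) (n : ℕ) (hn : 0 < n)
    (A q : Matrix (Fin n) (Fin n) R)
    (δ : Derivation ℤ (MvPolynomial (Fin n × Fin n) R) (MvPolynomial (Fin n × Fin n) R))
    (hδC : ∀ r : R, δ (MvPolynomial.C r) = MvPolynomial.C (D r))
    (hδX : ∀ j k : Fin n,
      δ (MvPolynomial.X (j, k)) = ((A.map ⇑MvPolynomial.C * genMat R n :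
        Matrix (Fin n) (Fin n) (MvPolynomial (Fin n × Fin n) R)) j k)) :
    (∀ j k : Fin n,
        δ (((genMat R n)ᵀ * q.map ⇑MvPolynomial.C * genMat R n :
          Matrix (Fin n) (Fin n) (MvPolynomial (Fin n × Fin n) R)) j k) = 0) ↔
      q.map (⇑D) + Aᵀ * q + q * A = 0 := by
  have hx : (genMat R n).map ⇑δ = A.map ⇑MvPolynomial.C * genMat R n := by
    ext1 j k
    exact hδX j k
  have hxt : ((genMat R n)ᵀ).map ⇑δ = (genMat R n)ᵀ * (Aᵀ).map ⇑MvPolynomial.C := by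
    rw [Matrix.transpose_map, hx, Matrix.transpose_mul, ← Matrix.transpose_map]
  have hq : (q.map ⇑MvPolynomial.C).map ⇑δ =
      (q.map ⇑D).map ⇑(MvPolynomial.C : R →+* MvPolynomial (Fin n × Fin n) R) := by
    ext1 j k
    exact hδC _
  have key : ((genMat R n)ᵀ * q.map ⇑MvPolynomial.C * genMat R n).map ⇑δ =
      (genMat R n)ᵀ * (q.map (⇑D) + Aᵀ * q + q * A).map
        ⇑(MvPolynomial.C : R →+* MvPolynomial (Fin n × Fin n) R) * genMat R n := by
    rw [stmt6_map_mul, stmt6_map_mul, hx, hxt, hq,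
      Matrix.map_add _ (map_add _), Matrix.map_add _ (map_add _), Matrix.map_mul, Matrix.map_mul]
    noncomm_ring
  constructor
  · intro h
    have h0 : ((genMat R n)ᵀ * q.map ⇑MvPolynomial.C * genMat R n).map ⇑δ = 0 := by
      ext1 j k
      exact h j k
    rw [key] at h0
    let e : MvPolynomial (Fin n × Fin n) R →+* R :=
      MvPolynomial.eval fun p => (1 : Matrix (Fin n) (Fin n) R) p.1 p.2
    have he : (genMat R n).map ⇑e = 1 := by
      ext1 j k
      simp [e, genMat]
    have hC : ∀ M : Matrix (Fin n) (Fin n) R, (M.map ⇑MvPolynomial.C).map ⇑e = M := by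
      intro M
      ext1 j k
      simp [e]
    have h1 := congrArg (fun M => M.map ⇑e) h0
    simp only [Matrix.map_mul, hC, Matrix.transpose_map, he] at h1
    simpa using h1
  · intro h j k
    rw [h] at key
    have := congrFun (congrFun key j) k
    simpa using this
end

section
/- Let B be a commutative ring and let p and p′ be two distinct primes. Let φ, φ′ : B → B be ring endomorphisms such that φ(b) ≡ b^p (mod pB) and φ′(b) ≡ b^{p′} (mod p′B) for all b ∈ B. Then for every b ∈ B the commutator value [φ, φ′](b) = φ(φ′(b)) − φ′(φ(b)) lies in the ideal p·p′·B; i.e., the commutator of a lift of the p-power Frobenius and a lift of the p′-power Frobenius is divisible by p·p′, so the curvature φ_{pp′} = (1/(pp′))[φ_p, φ_{p′}] is well defined when pp′ is a non-zero-divisor. -/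
/-- Let `B` be a commutative ring and `p ≠ p′` two primes. Let
`φ φ′ : B → B` be ring endomorphisms with `φ b ≡ b ^ p (mod p B)` and
`φ′ b ≡ b ^ p′ (mod p′ B)` for all `b`. Then for every `b` the commutator value
`[φ, φ′] b = φ (φ′ b) − φ′ (φ b)` lies in the ideal `p p′ B`: the commutator of a lift of
the `p`-power Frobenius and a lift of the `p′`-power Frobenius is divisible by `p p′`, so
the curvature `φ_{pp′} = (1/(p p′)) [φ_p, φ_{p′}]` is well defined when `p p′` is a
non-zero-divisor. -/
theorem stmt10 {B : Type*} [CommRing B] (p p' : ℕ) (hp : p.Prime) (hp' : p'.Prime)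
    (hne : p ≠ p') (φ φ' : B →+* B)
    (hφ : ∀ b : B, ∃ c : B, φ b - b ^ p = (p : B) * c)
    (hφ' : ∀ b : B, ∃ c : B, φ' b - b ^ p' = (p' : B) * c) :
    ∀ b : B, ∃ c : B, φ (φ' b) - φ' (φ b) = ((p : B) * (p' : B)) * c := by
  intro b
  have key : ∀ (q : ℕ) (f g : B →+* B) (_ : ∀ b : B, ∃ c : B, f b - b ^ q = (q : B) * c),
      (q : B) ∣ f (g b) - g (f b) := by
    intro q f g h
    obtain ⟨c, hc⟩ := h (g b)
    obtain ⟨d, hd⟩ := h b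
    have hd' := congrArg g hd
    simp only [map_sub, map_pow, map_mul, map_natCast] at hd'
    exact ⟨c - g d, by linear_combination hc - hd'⟩
  have h1 := key p φ φ' hφ
  have h2 : (p' : B) ∣ φ (φ' b) - φ' (φ b) := by
    have := key p' φ' φ hφ'
    rwa [dvd_sub_comm] at this
  have hco : IsCoprime (p : B) (p' : B) := by
    have := ((Nat.coprime_primes hp hp').2 hne)
    exact this.cast
  exact hco.mul_dvd h1 h2
end
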